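/- Let a<b be real, let p ∈ ]1,+∞[, and let ψ : ℝ → ]0,+∞[ be a bounded Borel function with ∫_{−∞}^{+∞} ψ(t)^{1/p} dt < +∞ and inf_K ψ > 0 for every compact K ⊂ ℝ. If u ∈ X^p_ψ(]a,b[), then (u')^a = Ψ_p^{-1}∘v is continuous on [a,b] with values in the extended reals; Z^±[(u')^a] = {x ∈ ]a,b[ : (u')^a(x) = ±∞}; lim_{x→x₀} (u')^a(x) = +∞ for every jump point x₀ of u with u₊(x₀) − u₋(x₀) > 0; and lim_{x→x₀} (u')^a(x) = −∞ for every jump point x₀ with u₊(x₀) − u₋(x₀) < 0. In particular, no nonconstant piecewise constant function belongs to X^p_ψ(]a,b[). -/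

import Mathlib

open MeasureTheory Filter Set Topology
open scoped ENNReal NNReal

noncomputable section

/-- `Ψ₁(t) = ∫_{-∞}^t ψ(s) ds`. -/
def Psi1 (ψ : ℝ → ℝ) (t : ℝ) : ℝ := ∫ s in Set.Iic t, ψ s

/-- `Ψ_p(t) = ∫_{-∞}^t ψ(s)^{1/p} ds`. -/
def Psip (ψ : ℝ → ℝ) (p t : ℝ) : ℝ := ∫ s in Set.Iic t, ψ s ^ (1 / p)

/-- The natural extension of `Ψ₁` to the extended reals:
`Ψ₁(-∞) = 0`, `Ψ₁(+∞) = ∫_ℝ ψ`. -/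
def Psi1E (ψ : ℝ → ℝ) (t : EReal) : ℝ :=
  if t = ⊤ then ∫ s, ψ s else if t = ⊥ then 0 else Psi1 ψ t.toReal

/-- Standing assumptions on `ψ` in the case `p = 1`: a bounded, everywhere positive
Borel function, integrable on `ℝ`, whose infimum on every compact set is positive. -/
structure PsiHyp (ψ : ℝ → ℝ) : Prop where
  measurable : Measurable ψ
  pos : ∀ t, 0 < ψ t
  bounded : ∃ C, ∀ t, ψ t ≤ C
  integrable : MeasureTheory.Integrable ψ
  inf_pos : ∀ K : Set ℝ, IsCompact K → ∃ δ > 0, ∀ t ∈ K, δ ≤ ψ t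

/-- Standing assumptions on `ψ` in the case `p > 1`: as in `PsiHyp` but with
`ψ^{1/p}` integrable on `ℝ`. -/
structure PsiHypP (ψ : ℝ → ℝ) (p : ℝ) : Prop where
  measurable : Measurable ψ
  pos : ∀ t, 0 < ψ t
  bounded : ∃ C, ∀ t, ψ t ≤ C
  integrable : MeasureTheory.Integrable fun t => ψ t ^ (1 / p)
  inf_pos : ∀ K : Set ℝ, IsCompact K → ∃ δ > 0, ∀ t ∈ K, δ ≤ ψ t

/-- `(μp, μn)` is the Jordan decomposition of the distributional derivative of
`u ∈ L¹(]a,b[)`; the existence of such a pair encodes `u ∈ BV(]a,b[)`,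
and `μp + μn` is the total variation measure `|u'|`. -/
def IsDerivMeasures (a b : ℝ) (u : ℝ → ℝ) (μp μn : Measure ℝ) : Prop :=
  MeasureTheory.IntegrableOn u (Set.Ioo a b) ∧
  IsFiniteMeasure μp ∧ IsFiniteMeasure μn ∧ μp ⟂ₘ μn ∧
  μp (Set.Ioo a b)ᶜ = 0 ∧ μn (Set.Ioo a b)ᶜ = 0 ∧
  ∀ φ : ℝ → ℝ, ContDiff ℝ 1 φ → tsupport φ ⊆ Set.Ioo a b →
    ∫ x in Set.Ioo a b, u x * deriv φ x = (∫ x, φ x ∂μn) - ∫ x, φ x ∂μp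

/-- The density `(u')^a` of the absolutely continuous part of the derivative whose
Jordan decomposition is `(μp, μn)`. -/
def uaD (μp μn : Measure ℝ) (x : ℝ) : ℝ :=
  (μp.rnDeriv MeasureTheory.volume x).toReal - (μn.rnDeriv MeasureTheory.volume x).toReal

/-- Left approximate limit `u₋(y) = lim_{ε→0⁺} ε⁻¹ ∫_{y-ε}^y u`. -/
def leftApproxLim (u : ℝ → ℝ) (y : ℝ) : ℝ :=
  limUnder (𝓝[>] (0 : ℝ)) fun ε => (∫ x in Set.Ioo (y - ε) y, u x) / ε

/-- Right approximate limit `u₊(y) = lim_{ε→0⁺} ε⁻¹ ∫_y^{y+ε} u`. -/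
def rightApproxLim (u : ℝ → ℝ) (y : ℝ) : ℝ :=
  limUnder (𝓝[>] (0 : ℝ)) fun ε => (∫ x in Set.Ioo y (y + ε), u x) / ε

/-- Left approximate limit computed in the extended reals (may be `±∞`). -/
def leftApproxLimE (u : ℝ → ℝ) (y : ℝ) : EReal :=
  limUnder (𝓝[>] (0 : ℝ)) fun ε => (((∫ x in Set.Ioo (y - ε) y, u x) / ε : ℝ) : EReal)

/-- Right approximate limit computed in the extended reals (may be `±∞`). -/
def rightApproxLimE (u : ℝ → ℝ) (y : ℝ) : EReal :=
  limUnder (𝓝[>] (0 : ℝ)) fun ε => (((∫ x in Set.Ioo y (y + ε), u x) / ε : ℝ) : EReal)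

/-- The jump set `S_u` of `u` in `]a,b[`. -/
def jumpSet (a b : ℝ) (u : ℝ → ℝ) : Set ℝ :=
  {y | y ∈ Set.Ioo a b ∧ leftApproxLim u y ≠ rightApproxLim u y}

/-- `ν_u = sign(u₊ - u₋)`. -/
def jumpSign (u : ℝ → ℝ) (y : ℝ) : ℝ :=
  Real.sign (rightApproxLim u y - leftApproxLim u y)

/-- `Z⁺[w] = {x ∈ ]a,b[ : lim_{ε→0⁺} (2ε)⁻¹∫_{x-ε}^{x+ε} w = +∞}`. -/
def ZPlus (a b : ℝ) (w : ℝ → ℝ) : Set ℝ :=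
  {x | x ∈ Set.Ioo a b ∧
    Tendsto (fun ε => (∫ t in Set.Ioo (x - ε) (x + ε), w t) / (2 * ε)) (𝓝[>] (0 : ℝ)) atTop}

/-- `Z⁻[w] = {x ∈ ]a,b[ : lim_{ε→0⁺} (2ε)⁻¹∫_{x-ε}^{x+ε} w = -∞}`. -/
def ZMinus (a b : ℝ) (w : ℝ → ℝ) : Set ℝ :=
  {x | x ∈ Set.Ioo a b ∧
    Tendsto (fun ε => (∫ t in Set.Ioo (x - ε) (x + ε), w t) / (2 * ε)) (𝓝[>] (0 : ℝ)) atBot}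

/-- The positive part `((u')^c)⁺` of the Cantor part of the derivative of `u`:
the singular part of `μp` with the atoms on the jump set removed. -/
def cantorPos (a b : ℝ) (u : ℝ → ℝ) (μp : Measure ℝ) : Measure ℝ :=
  (μp.singularPart MeasureTheory.volume).restrict (jumpSet a b u)ᶜ

/-- The negative part `((u')^c)⁻` of the Cantor part of the derivative of `u`. -/
def cantorNeg (a b : ℝ) (u : ℝ → ℝ) (μn : Measure ℝ) : Measure ℝ :=
  (μn.singularPart MeasureTheory.volume).restrict (jumpSet a b u)ᶜ

/-- `u ∈ X¹_ψ(]a,b[)`, with derivative data `(μp, μn)`:  `u ∈ BV(]a,b[)`,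
`Ψ₁∘(u')^a ∈ BV(]a,b[)`, and `((u')^c)^±` is concentrated on `Z^±[(u')^a]`. -/
def MemX1 (ψ : ℝ → ℝ) (a b : ℝ) (u : ℝ → ℝ) (μp μn : Measure ℝ) : Prop :=
  IsDerivMeasures a b u μp μn ∧
  (∃ νp νn : Measure ℝ, IsDerivMeasures a b (fun x => Psi1 ψ (uaD μp μn x)) νp νn) ∧
  cantorPos a b u μp (ZPlus a b (uaD μp μn))ᶜ = 0 ∧
  cantorNeg a b u μn (ZMinus a b (uaD μp μn))ᶜ = 0

/-- `f ∈ W^{1,p}(]a,b[)`: `f` has an absolutely continuous representative whose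
pointwise a.e. derivative lies in `L^p(]a,b[)`. -/
def MemW1pOn (p a b : ℝ) (f : ℝ → ℝ) : Prop :=
  ∃ g w : ℝ → ℝ,
    (∀ᵐ x ∂(MeasureTheory.volume.restrict (Set.Ioo a b)), g x = f x) ∧
    MeasureTheory.IntegrableOn w (Set.Ioo a b) ∧
    MeasureTheory.IntegrableOn (fun x => |w x| ^ p) (Set.Ioo a b) ∧
    ∀ x ∈ Set.Ioo a b, ∀ y ∈ Set.Ioo a b, g y - g x = ∫ t in x..y, w t

/-- `u ∈ X^p_ψ(]a,b[)`, with derivative data `(μp, μn)`:  `u ∈ BV(]a,b[)`,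
`Ψ_p∘(u')^a ∈ W^{1,p}(]a,b[)`, and `((u')^s)^±` is concentrated on `Z^±[(u')^a]`. -/
def MemXp (ψ : ℝ → ℝ) (p a b : ℝ) (u : ℝ → ℝ) (μp μn : Measure ℝ) : Prop :=
  IsDerivMeasures a b u μp μn ∧
  MemW1pOn p a b (fun x => Psip ψ p (uaD μp μn x)) ∧
  (μp.singularPart MeasureTheory.volume) (ZPlus a b (uaD μp μn))ᶜ = 0 ∧
  (μn.singularPart MeasureTheory.volume) (ZMinus a b (uaD μp μn))ᶜ = 0

/-- `u ∈ W^{2,p}(]a,b[)` with first derivative `v` and second derivative `w`. -/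
def W2pRep (p a b : ℝ) (u v w : ℝ → ℝ) : Prop :=
  (∀ x ∈ Set.Ioo a b, HasDerivAt u (v x) x) ∧
  (∀ x ∈ Set.Ioo a b, ∀ y ∈ Set.Ioo a b, v y - v x = ∫ t in x..y, w t) ∧
  MeasureTheory.IntegrableOn u (Set.Ioo a b) ∧
  MeasureTheory.IntegrableOn v (Set.Ioo a b) ∧
  MeasureTheory.IntegrableOn w (Set.Ioo a b) ∧
  MeasureTheory.IntegrableOn (fun x => |w x| ^ p) (Set.Ioo a b)

/-- The functional `F_p(u) = ∫_a^b |u'| + ∫_a^b ψ(u')|u''|^p` if `u ∈ W^{2,p}(]a,b[)`,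
`+∞` otherwise (as an infimum over Sobolev representations). -/
def Fp (ψ : ℝ → ℝ) (p a b : ℝ) (u : ℝ → ℝ) : ℝ≥0∞ :=
  ⨅ (v : ℝ → ℝ) (w : ℝ → ℝ) (_ : W2pRep p a b u v w),
    ENNReal.ofReal ((∫ x in Set.Ioo a b, |v x|) + ∫ x in Set.Ioo a b, ψ (v x) * |w x| ^ p)

/-- Strong `L¹(]a,b[)` convergence of a sequence. -/
def TendstoL1 (a b : ℝ) (U : ℕ → ℝ → ℝ) (u : ℝ → ℝ) : Prop :=
  (∀ k, MeasureTheory.IntegrableOn (U k) (Set.Ioo a b)) ∧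
  MeasureTheory.IntegrableOn u (Set.Ioo a b) ∧
  Tendsto (fun k => ∫ x in Set.Ioo a b, |U k x - u x|) atTop (𝓝 0)

/-- The relaxed functional
`F̄_p(u) = inf { liminf_k F_p(u_k) : u_k → u in L¹(]a,b[) }`. -/
def FpRel (ψ : ℝ → ℝ) (p a b : ℝ) (u : ℝ → ℝ) : ℝ≥0∞ :=
  ⨅ (U : ℕ → ℝ → ℝ) (_ : TendstoL1 a b U u),
    liminf (fun k => Fp ψ p a b (U k)) atTop

/-- `Φ(s, t₁, t₂)` of the relaxation formula (`s` being the sign of the jump). -/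
def Phi (ψ : ℝ → ℝ) (s : ℝ) (t₁ t₂ : EReal) : ℝ :=
  if 0 < s then ((∫ t, ψ t) - Psi1E ψ t₁) + ((∫ t, ψ t) - Psi1E ψ t₂)
  else Psi1E ψ t₁ + Psi1E ψ t₂

/-- `Φ̂(s, t₁, t₂)` of Remark 2.5. -/
def PhiHat (ψ : ℝ → ℝ) (s : ℝ) (t₁ t₂ : EReal) : ℝ :=
  if 0 < s then (∫ t, ψ t) - Psi1E ψ (max t₁ t₂)
  else Psi1E ψ (min t₁ t₂)

/-- `ubar` is a `C¹([a,b])` representative of `u`. -/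
def C1Rep (a b : ℝ) (u ubar : ℝ → ℝ) : Prop :=
  (∀ᵐ x ∂(MeasureTheory.volume.restrict (Set.Ioo a b)), ubar x = u x) ∧
  ContDiffOn ℝ 1 ubar (Set.Icc a b)

/-- `u` solves `min { F̄₁(w) + λ ∫_a^b (w - G)² : w ∈ X¹_ψ(]a,b[) }`. -/
def IsSolution1 (ψ : ℝ → ℝ) (a b lam : ℝ) (G u : ℝ → ℝ) : Prop :=
  (∃ μp μn : Measure ℝ, MemX1 ψ a b u μp μn) ∧
  ∀ w : ℝ → ℝ, (∃ ηp ηn : Measure ℝ, MemX1 ψ a b w ηp ηn) →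
    FpRel ψ 1 a b u + ENNReal.ofReal (lam * ∫ x in Set.Ioo a b, (u x - G x) ^ 2) ≤
    FpRel ψ 1 a b w + ENNReal.ofReal (lam * ∫ x in Set.Ioo a b, (w x - G x) ^ 2)

/-- `u` solves `min { F̄_p(w) + λ ∫_a^b |w - G|² : w ∈ X^p_ψ(]a,b[) }`. -/
def IsSolutionP (ψ : ℝ → ℝ) (p a b lam : ℝ) (G u : ℝ → ℝ) : Prop :=
  (∃ μp μn : Measure ℝ, MemXp ψ p a b u μp μn) ∧
  ∀ w : ℝ → ℝ, (∃ ηp ηn : Measure ℝ, MemXp ψ p a b w ηp ηn) →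
    FpRel ψ p a b u + ENNReal.ofReal (lam * ∫ x in Set.Ioo a b, (u x - G x) ^ 2) ≤
    FpRel ψ p a b w + ENNReal.ofReal (lam * ∫ x in Set.Ioo a b, (w x - G x) ^ 2)

/-- The Rudin–Osher–Fatemi energy `|w'|(]a,b[) + λ∫_a^b (w-g)²`, where `(ηp, ηn)`
is the Jordan decomposition of the derivative of `w`. -/
def ROFenergy (a b lam : ℝ) (g w : ℝ → ℝ) (ηp ηn : Measure ℝ) : ℝ≥0∞ :=
  (ηp + ηn) (Set.Ioo a b) + ENNReal.ofReal (lam * ∫ x in Set.Ioo a b, (w x - g x) ^ 2)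

/-- The left-continuous generalized inverse `g^{-1}(c) = inf {x ∈ [a,b] : g(x) ≥ c}`. -/
def gInv (a b : ℝ) (g : ℝ → ℝ) (c : ℝ) : ℝ :=
  sInf {x | x ∈ Set.Icc a b ∧ c ≤ g x}

end

noncomputable section
theorem exists_Icc_of_isCompact_subset_Ioo {a b : ℝ} {K : Set ℝ} (hK : IsCompact K)
    (hne : K.Nonempty) (hsub : K ⊆ Ioo a b) :
    ∃ α β, a < α ∧ β < b ∧ K ⊆ Icc α β := by
  obtain ⟨α, hα, hα'⟩ := hK.exists_isLeast hne
  obtain ⟨β, hβ, hβ'⟩ := hK.exists_isGreatest hne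
  exact ⟨α, β, (hsub hα).1, (hsub hβ).2, fun x hx => ⟨hα' hx, hβ' hx⟩⟩

/-- A compactly supported continuous function with zero mean is the derivative of a compactly
supported `C¹` function. -/
theorem exists_primitive_tsupport_subset {a b : ℝ} {ζ : ℝ → ℝ} (hζ : Continuous ζ)
    {K : Set ℝ} (hK : IsCompact K) (hne : K.Nonempty) (hsub : K ⊆ Ioo a b)
    (hzero : ∀ x ∉ K, ζ x = 0) (hint : ∫ x, ζ x = 0) :
    ∃ φ : ℝ → ℝ, ContDiff ℝ 1 φ ∧ tsupport φ ⊆ Ioo a b ∧ deriv φ = ζ := by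
  obtain ⟨α, β, hα, hβ, hKI⟩ := exists_Icc_of_isCompact_subset_Ioo hK hne hsub
  have hd : ∀ x, HasDerivAt (fun x => ∫ t in a..x, ζ t) (ζ x) x := fun x =>
    intervalIntegral.integral_hasDerivAt_right (hζ.intervalIntegrable _ _)
      (hζ.stronglyMeasurableAtFilter _ _) hζ.continuousAt
  have hderiv : deriv (fun x => ∫ t in a..x, ζ t) = ζ := funext fun x => (hd x).deriv
  refine ⟨fun x => ∫ t in a..x, ζ t, ?_, ?_, hderiv⟩
  · rw [contDiff_one_iff_deriv, hderiv]
    exact ⟨fun x => (hd x).differentiableAt, hζ⟩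
  · have hsupp : Function.support (fun x => ∫ t in a..x, ζ t) ⊆ Icc α β := by
      intro x hx
      by_contra hxI
      apply hx
      rcases lt_or_ge x α with h | h
      · have : EqOn ζ (fun _ => 0) (uIcc a x) := by
          intro t ht
          apply hzero
          intro htK
          have h1 := (hKI htK).1
          have h2 : t ≤ max a x := ht.2
          exact absurd (h1.trans h2) (not_le.2 (max_lt hα h))
        simp [intervalIntegral.integral_congr this]
      · have hβx : β < x := by
          by_contra h'
          exact hxI ⟨h, not_lt.1 h'⟩
        change ∫ t in a..x, ζ t = 0
        rw [intervalIntegral.integral_eq_integral_of_support_subset, hint]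
        intro t ht
        have htK : t ∈ K := by
          by_contra h'
          exact ht (hzero t h')
        exact ⟨hα.trans_le (hKI htK).1, (hKI htK).2.trans hβx.le⟩
    refine (closure_minimal hsupp isClosed_Icc).trans ?_
    exact fun x hx => ⟨hα.trans_le hx.1, hx.2.trans_lt hβ⟩

/-- The du Bois-Reymond lemma. -/
theorem ae_eq_const_of_integral_mul_deriv_eq_zero {a b : ℝ} (hab : a < b) {f : ℝ → ℝ}
    (hf : IntegrableOn f (Ioo a b))
    (h : ∀ φ : ℝ → ℝ, ContDiff ℝ 1 φ → tsupport φ ⊆ Ioo a b →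
      ∫ x in Ioo a b, f x * deriv φ x = 0) :
    ∃ c : ℝ, ∀ᵐ x ∂(volume.restrict (Ioo a b)), f x = c := by
  obtain ⟨m, hm⟩ := nonempty_Ioo.2 hab
  obtain ⟨ρ, hρs, hρc, hρd, hρr, hρm⟩ :=
    exists_contDiff_tsupport_subset (n := ⊤) (isOpen_Ioo.mem_nhds hm)
  have hI : 0 < ∫ x, ρ x :=
    hρd.continuous.integral_pos_of_hasCompactSupport_nonneg_nonzero hρc
      (fun x => (hρr (mem_range_self x)).1) (by rw [hρm]; exact one_ne_zero)
  have hmul : ∀ η : ℝ → ℝ, Continuous η → HasCompactSupport η →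
      Integrable (fun x => η x * f x) (volume.restrict (Ioo a b)) := fun η h1 h2 =>
    (hf.integrable.locallyIntegrable.integrable_smul_left_of_hasCompactSupport h1 h2)
  set c := (∫ x in Ioo a b, ρ x * f x) / ∫ x, ρ x with hc
  refine ⟨c, ?_⟩
  rw [ae_restrict_iff' measurableSet_Ioo]
  have key := isOpen_Ioo.ae_eq_zero_of_integral_contDiff_smul_eq_zero
    (f := fun x => f x - c) (μ := volume) (U := Ioo a b)
    ((hf.sub (integrableOn_const (by simp))).locallyIntegrableOn) ?_
  · filter_upwards [key] with x hx hx'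
    exact sub_eq_zero.1 (hx hx')
  intro η hηd hηc hηs
  have hηi : Integrable η := hηd.continuous.integrable_of_hasCompactSupport hηc
  have hρi : Integrable ρ := hρd.continuous.integrable_of_hasCompactSupport hρc
  set k := (∫ x, η x) / ∫ x, ρ x with hk
  obtain ⟨φ, hφd, hφs, hφ⟩ := exists_primitive_tsupport_subset (a := a) (b := b)
    (ζ := fun x => η x - k * ρ x)
    (hηd.continuous.sub (continuous_const.mul hρd.continuous))
    (hηc.isCompact.union hρc.isCompact)
    ⟨m, Or.inr (subset_tsupport _ (by simp [hρm]))⟩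
    (union_subset hηs hρs)
    (fun x hx => by
      rw [mem_union, not_or] at hx
      simp [image_eq_zero_of_notMem_tsupport hx.1, image_eq_zero_of_notMem_tsupport hx.2])
    (by
      rw [integral_sub hηi (hρi.const_mul _), integral_const_mul, hk]
      field_simp
      ring)
  have h0 := h φ hφd hφs
  rw [hφ] at h0
  have h1 : ∫ x in Ioo a b, f x * (η x - k * ρ x)
      = (∫ x in Ioo a b, η x * f x) - k * ∫ x in Ioo a b, ρ x * f x := by
    rw [← integral_const_mul, ← integral_sub (hmul η hηd.continuous hηc)
      ((hmul ρ hρd.continuous hρc).const_mul _)]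
    congr 1
    ext x
    ring
  have h2 : ∫ x, η x • (f x - c) = ∫ x in Ioo a b, η x • (f x - c) := by
    rw [setIntegral_eq_integral_of_forall_compl_eq_zero]
    intro x hx
    rw [image_eq_zero_of_notMem_tsupport fun h' => hx (hηs h'), zero_smul]
  have h3 : ∫ x in Ioo a b, η x = ∫ x, η x := by
    rw [setIntegral_eq_integral_of_forall_compl_eq_zero]
    intro x hx
    exact image_eq_zero_of_notMem_tsupport fun h' => hx (hηs h')
  have h4 : ∫ x in Ioo a b, η x • (f x - c)
      = (∫ x in Ioo a b, η x * f x) - c * ∫ x in Ioo a b, η x := by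
    rw [← integral_const_mul, ← integral_sub (hmul η hηd.continuous hηc)
      (hηi.integrableOn.const_mul _)]
    congr 1
    ext x
    simp only [smul_eq_mul]
    ring
  rw [h2, h4, h3]
  rw [h1] at h0
  rw [← h0, hc, hk]
  field_simp

/-- Integration by parts against the distribution function of a finite measure. -/
theorem integral_eq_neg_integral_deriv_mul_measureReal_Iic (μ : Measure ℝ) [IsFiniteMeasure μ]
    {φ : ℝ → ℝ} (hφ : ContDiff ℝ 1 φ) (hc : HasCompactSupport φ) :
    ∫ x, φ x ∂μ = -∫ y, deriv φ y * μ.real (Iic y) := by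
  have hdi : Integrable (deriv φ) :=
    (hφ.continuous_deriv le_rfl).integrable_of_hasCompactSupport hc.deriv
  have hS : MeasurableSet {q : ℝ × ℝ | q.1 ≤ q.2} := measurableSet_le measurable_fst measurable_snd
  have hprod : Integrable
      (Function.uncurry fun x y => (Ici x).indicator (deriv φ) y) (μ.prod volume) := by
    have h1 : Integrable (fun q : ℝ × ℝ => deriv φ q.2) (μ.prod volume) := hdi.comp_snd μ
    refine (h1.indicator hS).congr (Eventually.of_forall fun q => ?_)
    simp [Function.uncurry, indicator]
  have hx : ∀ x, φ x = -∫ y, (Ici x).indicator (deriv φ) y := by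
    intro x
    rw [integral_indicator measurableSet_Ici, integral_Ici_eq_integral_Ioi,
      hc.integral_Ioi_deriv_eq hφ, neg_neg]
  have hy : ∀ y, ∫ x, (Ici x).indicator (deriv φ) y ∂μ = deriv φ y * μ.real (Iic y) := by
    intro y
    have : (fun x => (Ici x).indicator (deriv φ) y) = (Iic y).indicator fun _ => deriv φ y := by
      ext x
      simp [indicator]
    rw [this, integral_indicator measurableSet_Iic]
    simp [mul_comm]
  calc ∫ x, φ x ∂μ = ∫ x, (-∫ y, (Ici x).indicator (deriv φ) y) ∂μ := by simp_rw [← hx]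
    _ = -∫ y, (∫ x, (Ici x).indicator (deriv φ) y ∂μ) := by
      rw [integral_neg, integral_integral_swap hprod]
    _ = _ := by simp_rw [hy]

theorem monotone_measureReal_Iic (μ : Measure ℝ) [IsFiniteMeasure μ] :
    Monotone fun x => μ.real (Iic x) := fun _ _ h => measureReal_mono (Iic_subset_Iic.2 h)

/-- A function of bounded variation agrees a.e. with the distribution function of its
derivative, up to a constant. -/
theorem IsDerivMeasures.exists_ae_eq_const_add {a b : ℝ} (hab : a < b) {u : ℝ → ℝ}
    {μp μn : Measure ℝ} (h : IsDerivMeasures a b u μp μn) :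
    ∃ c : ℝ, ∀ᵐ x ∂(volume.restrict (Ioo a b)),
      u x = c + (μp.real (Iic x) - μn.real (Iic x)) := by
  obtain ⟨hu, hfp, hfn, -, -, -, hφ⟩ := h
  have hli : ∀ (μ : Measure ℝ) [IsFiniteMeasure μ], LocallyIntegrable fun x => μ.real (Iic x) :=
    fun μ _ => (monotone_measureReal_Iic μ).locallyIntegrable
  have hI : ∀ (μ : Measure ℝ) [IsFiniteMeasure μ],
      IntegrableOn (fun x => μ.real (Iic x)) (Ioo a b) := fun μ _ =>
    ((hli μ).integrableOn_isCompact isCompact_Icc).mono_set Ioo_subset_Icc_self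
  obtain ⟨c, hc⟩ := ae_eq_const_of_integral_mul_deriv_eq_zero hab
    (f := fun x => u x - (μp.real (Iic x) - μn.real (Iic x)))
    (hu.sub ((hI μp).sub (hI μn))) (by
      intro φ hd hs
      have hcs : HasCompactSupport φ :=
        isCompact_Icc.of_isClosed_subset (isClosed_tsupport _) (hs.trans Ioo_subset_Icc_self)
      have hcd : Continuous (deriv φ) := hd.continuous_deriv le_rfl
      have hmul : ∀ f : ℝ → ℝ, LocallyIntegrable f (volume.restrict (Ioo a b)) →
          Integrable (fun x => f x * deriv φ x) (volume.restrict (Ioo a b)) := by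
        intro f hf
        simpa [mul_comm] using hf.integrable_smul_left_of_hasCompactSupport hcd hcs.deriv
      have hF : ∀ (μ : Measure ℝ) [IsFiniteMeasure μ],
          ∫ x in Ioo a b, μ.real (Iic x) * deriv φ x = -∫ x, φ x ∂μ := by
        intro μ _
        rw [integral_eq_neg_integral_deriv_mul_measureReal_Iic μ hd hcs, neg_neg,
          setIntegral_eq_integral_of_forall_compl_eq_zero]
        · simp_rw [mul_comm]
        · intro x hx
          rw [image_eq_zero_of_notMem_tsupport
            fun h' => hx (hs (tsupport_deriv_subset h')), mul_zero]
      have e : ∀ x, (u x - (μp.real (Iic x) - μn.real (Iic x))) * deriv φ x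
          = u x * deriv φ x - (μp.real (Iic x) * deriv φ x - μn.real (Iic x) * deriv φ x) := by
        intro x; ring
      simp_rw [e]
      have ip := hmul _ (hI μp).integrable.locallyIntegrable
      have inn := hmul _ (hI μn).integrable.locallyIntegrable
      rw [integral_sub (g := fun x => μp.real (Iic x) * deriv φ x - μn.real (Iic x) * deriv φ x)
        (hmul u hu.integrable.locallyIntegrable) (ip.sub inn),
        integral_sub ip inn, hF, hF, hφ φ hd hs]
      ring)
  exact ⟨c, hc.mono fun x hx => by linarith⟩

/-! ### One-sided limits -/

theorem tendsto_measureReal_Iic_nhdsGT (μ : Measure ℝ) [IsFiniteMeasure μ] (y : ℝ) :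
    Tendsto (fun x => μ.real (Iic x)) (𝓝[>] y) (𝓝 (μ.real (Iic y))) := by
  have e : ∀ s : Set ℝ, MeasurableSet s → μ.real s = ∫ z, s.indicator 1 z ∂μ := fun s hs =>
    (integral_indicator_one hs).symm
  simp_rw [e _ measurableSet_Iic]
  refine tendsto_integral_filter_of_dominated_convergence (fun _ => 1)
    (Eventually.of_forall fun x => (measurable_one.indicator measurableSet_Iic).aestronglyMeasurable)
    (Eventually.of_forall fun x => Eventually.of_forall fun z => ?_) (integrable_const _)
    (Eventually.of_forall fun z => ?_)
  · by_cases h : z ∈ Iic x <;> simp [h]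
  · apply tendsto_const_nhds.congr'
    rcases le_or_gt z y with h | h
    · filter_upwards [self_mem_nhdsWithin] with x (hx : y < x)
      simp [indicator, h, h.trans hx.le]
    · filter_upwards [mem_nhdsWithin_of_mem_nhds (Iio_mem_nhds h)] with x (hx : x < z)
      simp [indicator, not_le.2 h, not_le.2 hx]

theorem tendsto_measureReal_Iic_nhdsLT (μ : Measure ℝ) [IsFiniteMeasure μ] (y : ℝ) :
    Tendsto (fun x => μ.real (Iic x)) (𝓝[<] y) (𝓝 (μ.real (Iio y))) := by
  have e : ∀ s : Set ℝ, MeasurableSet s → μ.real s = ∫ z, s.indicator 1 z ∂μ := fun s hs =>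
    (integral_indicator_one hs).symm
  simp_rw [e _ measurableSet_Iic, e _ measurableSet_Iio]
  refine tendsto_integral_filter_of_dominated_convergence (fun _ => 1)
    (Eventually.of_forall fun x => (measurable_one.indicator measurableSet_Iic).aestronglyMeasurable)
    (Eventually.of_forall fun x => Eventually.of_forall fun z => ?_) (integrable_const _)
    (Eventually.of_forall fun z => ?_)
  · by_cases h : z ∈ Iic x <;> simp [h]
  · apply tendsto_const_nhds.congr'
    rcases lt_or_ge z y with h | h
    · filter_upwards [mem_nhdsWithin_of_mem_nhds (Ioi_mem_nhds h)] with x (hx : z < x)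
      simp [indicator, h, hx.le]
    · filter_upwards [self_mem_nhdsWithin] with x (hx : x < y)
      simp [indicator, not_lt.2 h, not_le.2 (hx.trans_le h)]

theorem rightApproxLim_eq_of_tendsto {a b y L : ℝ} {u v : ℝ → ℝ} (hy : y ∈ Ioo a b)
    (hu : IntegrableOn u (Ioo a b)) (huv : ∀ᵐ x ∂(volume.restrict (Ioo a b)), u x = v x)
    (hv : Tendsto v (𝓝[>] y) (𝓝 L)) : rightApproxLim u y = L := by
  apply Tendsto.limUnder_eq
  rw [Metric.tendsto_nhds]
  intro η hη
  have h1 : ∀ᶠ x in 𝓝[>] y, |v x - L| ≤ η / 2 := by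
    filter_upwards [Metric.tendsto_nhds.1 hv (η / 2) (half_pos hη)] with x hx
    exact (Real.dist_eq _ _ ▸ hx).le
  obtain ⟨z, hz, hzs⟩ := mem_nhdsGT_iff_exists_Ioo_subset.1 h1
  have hz' : (0 : ℝ) < min z b - y := sub_pos.2 (lt_min hz hy.2)
  filter_upwards [Ioo_mem_nhdsGT hz'] with ε hε
  have hε0 := hε.1
  have hεz : y + ε < min z b := by linarith [hε.2]
  have hsub : Ioo y (y + ε) ⊆ Ioo a b := Ioo_subset_Ioo hy.1.le (hεz.le.trans (min_le_right _ _))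
  have hae : ∀ᵐ x ∂(volume.restrict (Ioo y (y + ε))), ‖u x - L‖ ≤ η / 2 := by
    filter_upwards [ae_restrict_of_ae_restrict_of_subset hsub huv,
      ae_restrict_mem measurableSet_Ioo] with x hx hxI
    rw [hx]
    exact hzs ⟨hxI.1, hxI.2.trans (hεz.trans_le (min_le_left _ _))⟩
  have hb := norm_setIntegral_le_of_norm_le_const_ae (by simp) hae
  rw [integral_sub (hu.mono_set hsub) (integrableOn_const (by simp))] at hb
  simp only [integral_const, measureReal_restrict_apply_univ, Real.volume_real_Ioo, smul_eq_mul,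
    add_sub_cancel_left, max_eq_left hε0.le, Real.norm_eq_abs] at hb
  rw [Real.dist_eq, show (∫ x in Ioo y (y + ε), u x) / ε - L
    = ((∫ x in Ioo y (y + ε), u x) - ε * L) / ε by field_simp, abs_div, abs_of_pos hε0,
    div_lt_iff₀ hε0]
  nlinarith

theorem leftApproxLim_eq_of_tendsto {a b y L : ℝ} {u v : ℝ → ℝ} (hy : y ∈ Ioo a b)
    (hu : IntegrableOn u (Ioo a b)) (huv : ∀ᵐ x ∂(volume.restrict (Ioo a b)), u x = v x)
    (hv : Tendsto v (𝓝[<] y) (𝓝 L)) : leftApproxLim u y = L := by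
  apply Tendsto.limUnder_eq
  rw [Metric.tendsto_nhds]
  intro η hη
  have h1 : ∀ᶠ x in 𝓝[<] y, |v x - L| ≤ η / 2 := by
    filter_upwards [Metric.tendsto_nhds.1 hv (η / 2) (half_pos hη)] with x hx
    exact (Real.dist_eq _ _ ▸ hx).le
  obtain ⟨z, hz, hzs⟩ := mem_nhdsLT_iff_exists_Ioo_subset.1 h1
  have hz' : (0 : ℝ) < y - max z a := sub_pos.2 (max_lt hz hy.1)
  filter_upwards [Ioo_mem_nhdsGT hz'] with ε hε
  have hε0 := hε.1
  have hεz : max z a < y - ε := by linarith [hε.2]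
  have hsub : Ioo (y - ε) y ⊆ Ioo a b := Ioo_subset_Ioo ((le_max_right _ _).trans hεz.le) hy.2.le
  have hae : ∀ᵐ x ∂(volume.restrict (Ioo (y - ε) y)), ‖u x - L‖ ≤ η / 2 := by
    filter_upwards [ae_restrict_of_ae_restrict_of_subset hsub huv,
      ae_restrict_mem measurableSet_Ioo] with x hx hxI
    rw [hx]
    exact hzs ⟨((le_max_left _ _).trans_lt hεz).trans hxI.1, hxI.2⟩
  have hb := norm_setIntegral_le_of_norm_le_const_ae (by simp) hae
  rw [integral_sub (hu.mono_set hsub) (integrableOn_const (by simp))] at hb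
  simp only [integral_const, measureReal_restrict_apply_univ, Real.volume_real_Ioo, smul_eq_mul,
    sub_sub_cancel, max_eq_left hε0.le, Real.norm_eq_abs] at hb
  rw [Real.dist_eq, show (∫ x in Ioo (y - ε) y, u x) / ε - L
    = ((∫ x in Ioo (y - ε) y, u x) - ε * L) / ε by field_simp, abs_div, abs_of_pos hε0,
    div_lt_iff₀ hε0]
  nlinarith

/-- The jump of a function of bounded variation is the mass of the point under its derivative. -/
theorem rightApproxLim_sub_leftApproxLim {a b c y : ℝ} {u : ℝ → ℝ} {μp μn : Measure ℝ}
    [IsFiniteMeasure μp] [IsFiniteMeasure μn] (hy : y ∈ Ioo a b)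
    (hu : IntegrableOn u (Ioo a b))
    (h : ∀ᵐ x ∂(volume.restrict (Ioo a b)), u x = c + (μp.real (Iic x) - μn.real (Iic x))) :
    rightApproxLim u y - leftApproxLim u y = μp.real {y} - μn.real {y} := by
  rw [rightApproxLim_eq_of_tendsto hy hu h (tendsto_const_nhds.add
      ((tendsto_measureReal_Iic_nhdsGT μp y).sub (tendsto_measureReal_Iic_nhdsGT μn y))),
    leftApproxLim_eq_of_tendsto hy hu h (tendsto_const_nhds.add
      ((tendsto_measureReal_Iic_nhdsLT μp y).sub (tendsto_measureReal_Iic_nhdsLT μn y)))]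
  have e : ∀ (μ : Measure ℝ) [IsFiniteMeasure μ], μ.real (Iic y) = μ.real (Iio y) + μ.real {y} := by
    intro μ _
    rw [← Iio_union_right, measureReal_union (by simp) (measurableSet_singleton y)]
  rw [e μp, e μn]
  ring

/-! ### The function `Ψ_p` and the extended-real representative -/

theorem PsiHypP.rpow_pos {ψ : ℝ → ℝ} {p : ℝ} (hψ : PsiHypP ψ p) (t : ℝ) : 0 < ψ t ^ (1 / p) :=
  Real.rpow_pos_of_pos (hψ.pos t) _

theorem PsiHypP.Psip_sub {ψ : ℝ → ℝ} {p : ℝ} (hψ : PsiHypP ψ p) (s t : ℝ) :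
    Psip ψ p t - Psip ψ p s = ∫ r in s..t, ψ r ^ (1 / p) :=
  intervalIntegral.integral_Iic_sub_Iic hψ.integrable.integrableOn hψ.integrable.integrableOn

theorem PsiHypP.strictMono_Psip {ψ : ℝ → ℝ} {p : ℝ} (hψ : PsiHypP ψ p) :
    StrictMono (Psip ψ p) := by
  intro s t hst
  rw [← sub_pos, hψ.Psip_sub]
  exact intervalIntegral.intervalIntegral_pos_of_pos_on hψ.integrable.intervalIntegrable
    (fun x _ => hψ.rpow_pos x) hst

theorem PsiHypP.continuous_Psip {ψ : ℝ → ℝ} {p : ℝ} (hψ : PsiHypP ψ p) :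
    Continuous (Psip ψ p) := by
  have : Psip ψ p = fun t => Psip ψ p 0 + ∫ r in (0 : ℝ)..t, ψ r ^ (1 / p) := by
    ext t
    rw [← hψ.Psip_sub]
    ring
  rw [this]
  exact continuous_const.add
    (intervalIntegral.continuous_primitive (fun _ _ => hψ.integrable.intervalIntegrable) 0)

/-- The inverse of an increasing function `Ψ`, with values in the extended reals. -/
def invE (Ψ : ℝ → ℝ) (y : ℝ) : EReal := sSup ((↑) '' {t : ℝ | Ψ t ≤ y})

theorem coe_lt_invE_iff {Ψ : ℝ → ℝ} (hm : StrictMono Ψ) (hc : Continuous Ψ) {t y : ℝ} :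
    (t : EReal) < invE Ψ y ↔ Ψ t < y := by
  constructor
  · intro h
    obtain ⟨_, ⟨s, hs, rfl⟩, hts⟩ := lt_sSup_iff.1 h
    exact (hm (EReal.coe_lt_coe_iff.1 hts)).trans_le hs
  · intro h
    obtain ⟨s, hs, hts⟩ := (((hc.tendsto t).eventually (gt_mem_nhds h)).filter_mono
      nhdsWithin_le_nhds |>.and (self_mem_nhdsWithin (s := Ioi t))).exists
    exact lt_sSup_iff.2 ⟨s, ⟨s, le_of_lt hs, rfl⟩, EReal.coe_lt_coe_iff.2 hts⟩

theorem invE_lt_coe_iff {Ψ : ℝ → ℝ} (hm : StrictMono Ψ) (hc : Continuous Ψ) {t y : ℝ} :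
    invE Ψ y < (t : EReal) ↔ y < Ψ t := by
  constructor
  · intro h
    obtain ⟨r, hr, hrt⟩ := EReal.lt_iff_exists_real_btwn.1 h
    by_contra! hle
    exact not_le.2 h (le_sSup ⟨t, hle, rfl⟩)
  · intro h
    obtain ⟨s, hs, hts⟩ := (((hc.tendsto t).eventually (lt_mem_nhds h)).filter_mono
      nhdsWithin_le_nhds |>.and (self_mem_nhdsWithin (s := Iio t))).exists
    refine lt_of_le_of_lt (sSup_le ?_) (EReal.coe_lt_coe_iff.2 hts)
    rintro _ ⟨r, hr, rfl⟩
    exact EReal.coe_le_coe_iff.2 (hm.lt_iff_lt.1 (lt_of_le_of_lt hr hs)).le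

theorem invE_apply {Ψ : ℝ → ℝ} (hm : StrictMono Ψ) (hc : Continuous Ψ) (t : ℝ) :
    invE Ψ (Ψ t) = t :=
  le_antisymm (not_lt.1 fun h => lt_irrefl _ ((coe_lt_invE_iff hm hc).1 h))
    (not_lt.1 fun h => lt_irrefl _ ((invE_lt_coe_iff hm hc).1 h))

theorem continuous_invE {Ψ : ℝ → ℝ} (hm : StrictMono Ψ) (hc : Continuous Ψ) :
    Continuous (invE Ψ) := by
  refine continuous_iff_continuousAt.2 fun y => tendsto_order.2 ⟨fun c hcy => ?_, fun c hcy => ?_⟩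
  · obtain ⟨r, hr, hry⟩ := EReal.lt_iff_exists_real_btwn.1 hcy
    filter_upwards [lt_mem_nhds ((coe_lt_invE_iff hm hc).1 hry)] with z hz
    exact hr.trans ((coe_lt_invE_iff hm hc).2 hz)
  · obtain ⟨r, hr, hry⟩ := EReal.lt_iff_exists_real_btwn.1 hcy
    filter_upwards [gt_mem_nhds ((invE_lt_coe_iff hm hc).1 hr)] with z hz
    exact ((invE_lt_coe_iff hm hc).2 hz).trans hry

/-- A function in `W^{1,p}(]a,b[)` has a representative which is continuous on `[a,b]`. -/
theorem MemW1pOn.exists_continuousOn {p a b : ℝ} (hab : a < b) {f : ℝ → ℝ}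
    (hf : MemW1pOn p a b f) :
    ∃ G : ℝ → ℝ, ContinuousOn G (Icc a b) ∧
      ∀ᵐ x ∂(volume.restrict (Ioo a b)), G x = f x := by
  obtain ⟨g, w, hg, hw, -, hgw⟩ := hf
  obtain ⟨m, hm⟩ := nonempty_Ioo.2 hab
  refine ⟨fun x => g m + ∫ t in m..x, w t, ?_, ?_⟩
  · have hwi : IntervalIntegrable w volume a b :=
      (intervalIntegrable_iff_integrableOn_Ioo_of_le hab.le).2 hw
    have := intervalIntegral.continuousOn_primitive_interval' hwi
      (a := m) (by rw [uIcc_of_le hab.le]; exact Ioo_subset_Icc_self hm)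
    rw [uIcc_of_le hab.le] at this
    exact continuousOn_const.add this
  · filter_upwards [hg, ae_restrict_mem measurableSet_Ioo] with x hx hxI
    rw [← hx, ← hgw m hm x hxI]
    ring

/-! ### The sets `Z^±` -/

theorem eventually_le_average {a b x r : ℝ} {W : ℝ → EReal} {h : ℝ → ℝ} (hx : x ∈ Ioo a b)
    (hW : ContinuousOn W (Icc a b)) (hi : Integrable h)
    (hWh : ∀ᵐ x ∂(volume.restrict (Ioo a b)), W x = (h x : EReal)) (hr : r < W x) :
    ∀ᶠ ε in 𝓝[>] (0 : ℝ), r ≤ (∫ t in Ioo (x - ε) (x + ε), h t) / (2 * ε) := by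
  have hn : ∀ᶠ y in 𝓝 x, r < W y ∧ y ∈ Ioo a b :=
    ((hW.continuousAt (Icc_mem_nhds hx.1 hx.2)).eventually (lt_mem_nhds hr)).and
      (isOpen_Ioo.mem_nhds hx)
  obtain ⟨δ, hδ, hball⟩ := Metric.eventually_nhds_iff_ball.1 hn
  filter_upwards [Ioo_mem_nhdsGT hδ] with ε hε
  have hε0 := hε.1
  have hb : ∀ y ∈ Ioo (x - ε) (x + ε), r < W y ∧ y ∈ Ioo a b := by
    intro y hy
    apply hball
    rw [Real.ball_eq_Ioo]
    exact ⟨by linarith [hy.1, hε.2], by linarith [hy.2, hε.2]⟩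
  have hmono : ∫ t in Ioo (x - ε) (x + ε), r ≤ ∫ t in Ioo (x - ε) (x + ε), h t := by
    refine integral_mono_ae (integrableOn_const (by simp)) hi.integrableOn ?_
    filter_upwards [ae_restrict_of_ae_restrict_of_subset (fun y hy => (hb y hy).2) hWh,
      ae_restrict_mem measurableSet_Ioo] with y hy hyI
    have := (hb y hyI).1
    rw [hy] at this
    exact (EReal.coe_lt_coe_iff.1 this).le
  simp only [integral_const, measureReal_restrict_apply_univ, Real.volume_real_Ioo,
    smul_eq_mul] at hmono
  rw [max_eq_left (by linarith)] at hmono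
  rw [le_div_iff₀ (by linarith)]
  linarith

theorem ZMinus_eq_ZPlus_neg (a b : ℝ) (h : ℝ → ℝ) : ZMinus a b h = ZPlus a b fun x => -h x := by
  ext x
  simp only [ZMinus, ZPlus, mem_ofPred_eq, integral_neg, neg_div, tendsto_neg_atTop_iff]

theorem neg_ae_eq {s : Set ℝ} {W : ℝ → EReal} {h : ℝ → ℝ}
    (hWh : ∀ᵐ x ∂(volume.restrict s), W x = (h x : EReal)) :
    ∀ᵐ x ∂(volume.restrict s), -W x = ((-h x : ℝ) : EReal) :=
  hWh.mono fun x hx => by rw [hx, EReal.coe_neg]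

theorem ZPlus_eq {a b : ℝ} {W : ℝ → EReal} {h : ℝ → ℝ}
    (hW : ContinuousOn W (Icc a b)) (hi : Integrable h)
    (hWh : ∀ᵐ x ∂(volume.restrict (Ioo a b)), W x = (h x : EReal)) :
    ZPlus a b h = {x | x ∈ Ioo a b ∧ W x = ⊤} := by
  ext x
  refine and_congr_right fun hx => ⟨fun ht => ?_, fun ht => ?_⟩
  · by_contra hne
    obtain ⟨r, hr, -⟩ := EReal.lt_iff_exists_real_btwn.1 (lt_top_iff_ne_top.2 hne)
    have := eventually_le_average (r := -r) hx (continuous_neg.comp_continuousOn hW) hi.neg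
      (neg_ae_eq hWh) (by rw [EReal.coe_neg]; exact EReal.neg_lt_neg_iff.2 hr)
    obtain ⟨ε, h1, h2⟩ := (this.and (ht.eventually_gt_atTop r)).exists
    simp only [Pi.neg_apply, integral_neg, neg_div] at h1
    linarith
  · exact tendsto_atTop.2 fun r =>
      eventually_le_average hx hW hi hWh (by rw [ht]; exact EReal.coe_lt_top r)

theorem ZMinus_eq {a b : ℝ} {W : ℝ → EReal} {h : ℝ → ℝ}
    (hW : ContinuousOn W (Icc a b)) (hi : Integrable h)
    (hWh : ∀ᵐ x ∂(volume.restrict (Ioo a b)), W x = (h x : EReal)) :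
    ZMinus a b h = {x | x ∈ Ioo a b ∧ W x = ⊥} := by
  rw [ZMinus_eq_ZPlus_neg,
    ZPlus_eq (h := fun x => -h x) (continuous_neg.comp_continuousOn hW) hi.neg (neg_ae_eq hWh)]
  simp

/-! ### Piecewise constant functions -/

theorem measureReal_eq_singularPart_add (μ : Measure ℝ) [IsFiniteMeasure μ] (S : Set ℝ) :
    μ.real S = (μ.singularPart volume).real S + ∫ x in S, (μ.rnDeriv volume x).toReal := by
  rw [Measure.setIntegral_toReal_rnDeriv_eq_withDensity S, ← measureReal_add_apply,
    Measure.singularPart_add_rnDeriv]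

theorem integrable_uaD (μp μn : Measure ℝ) [IsFiniteMeasure μp] [IsFiniteMeasure μn] :
    Integrable (uaD μp μn) :=
  Measure.integrable_toReal_rnDeriv.sub Measure.integrable_toReal_rnDeriv

theorem uaD_swap (μp μn : Measure ℝ) (x : ℝ) : uaD μn μp x = -uaD μp μn x :=
  (neg_sub _ _).symm

theorem measureReal_Iic_sub_eq (μp μn : Measure ℝ) [IsFiniteMeasure μp] [IsFiniteMeasure μn]
    {y z : ℝ} (hyz : y ≤ z) :
    (μp.real (Iic z) - μn.real (Iic z)) - (μp.real (Iic y) - μn.real (Iic y))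
      = (μp.singularPart volume).real (Ioc y z) - (μn.singularPart volume).real (Ioc y z)
        + ∫ x in Ioc y z, uaD μp μn x := by
  have e : ∀ (μ : Measure ℝ) [IsFiniteMeasure μ],
      μ.real (Iic z) = μ.real (Iic y) + μ.real (Ioc y z) := by
    intro μ _
    rw [← Iic_union_Ioc_eq_Iic hyz, measureReal_union (Iic_disjoint_Ioc le_rfl) measurableSet_Ioc]
  have hsub : ∫ x in Ioc y z, uaD μp μn x = (∫ x in Ioc y z, (μp.rnDeriv volume x).toReal)
      - ∫ x in Ioc y z, (μn.rnDeriv volume x).toReal :=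
    integral_sub Measure.integrable_toReal_rnDeriv.integrableOn
      Measure.integrable_toReal_rnDeriv.integrableOn
  rw [e μp, e μn, hsub, measureReal_eq_singularPart_add μp (Ioc y z),
    measureReal_eq_singularPart_add μn (Ioc y z)]
  ring

theorem le_zero_of_finite_image {a b c x : ℝ} {s : ℝ → ℝ} {W : ℝ → EReal} {μp μn : Measure ℝ}
    [IsFiniteMeasure μp] [IsFiniteMeasure μn] (hW : ContinuousOn W (Icc a b))
    (hWh : ∀ᵐ x ∂(volume.restrict (Ioo a b)), W x = (uaD μp μn x : EReal))
    (hs : (s '' Ioo a b).Finite)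
    (hsF : ∀ᵐ x ∂(volume.restrict (Ioo a b)), s x = c + (μp.real (Iic x) - μn.real (Iic x)))
    (hn : (μn.singularPart volume) (ZMinus a b (uaD μp μn))ᶜ = 0) (hx : x ∈ Ioo a b) :
    W x ≤ 0 := by
  by_contra! h0
  have hnh : ∀ᶠ y in 𝓝 x, 0 < W y ∧ y ∈ Ioo a b :=
    ((hW.continuousAt (Icc_mem_nhds hx.1 hx.2)).eventually (lt_mem_nhds h0)).and
      (isOpen_Ioo.mem_nhds hx)
  obtain ⟨δ, hδ, hball⟩ := Metric.eventually_nhds_iff_ball.1 hnh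
  rw [Real.ball_eq_Ioo] at hball
  set I := Ioo (x - δ) (x + δ) with hI
  have hIsub : I ⊆ Ioo a b := fun y hy => (hball y hy).2
  set F : ℝ → ℝ := fun x => c + (μp.real (Iic x) - μn.real (Iic x)) with hF
  have hpos : ∀ᵐ t ∂(volume.restrict I), 0 < uaD μp μn t := by
    filter_upwards [ae_restrict_of_ae_restrict_of_subset hIsub hWh,
      ae_restrict_mem measurableSet_Ioo] with t ht htI
    have := (hball t htI).1
    rw [ht] at this
    exact EReal.coe_pos.1 this
  have hmono : StrictMonoOn F I := by
    intro y hy z hz hyz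
    have hsubI : Ioc y z ⊆ I := fun t ht => ⟨hy.1.trans ht.1, ht.2.trans_lt hz.2⟩
    have hsing : (μn.singularPart volume).real (Ioc y z) = 0 := by
      rw [measureReal_eq_zero_iff]
      refine measure_mono_null (fun t ht => ?_) hn
      intro htZ
      rw [ZMinus_eq hW (integrable_uaD μp μn) hWh] at htZ
      have := (hball t (hsubI ht)).1
      rw [htZ.2] at this
      exact not_lt_bot this
    have hint : 0 < ∫ t in Ioc y z, uaD μp μn t := by
      have hp' := ae_restrict_of_ae_restrict_of_subset hsubI hpos
      refine (integral_pos_iff_support_of_nonneg_ae (hp'.mono fun t ht => ht.le)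
        (integrable_uaD μp μn).integrableOn).2 ?_
      have hfull : Function.support (uaD μp μn) =ᵐ[volume.restrict (Ioc y z)] univ :=
        eventuallyEq_univ.2 (hp'.mono fun t ht => ht.ne')
      rw [measure_congr hfull]
      simpa using hyz
    have hd := measureReal_Iic_sub_eq μp μn hyz.le
    have hnn : 0 ≤ (μp.singularPart volume).real (Ioc y z) := measureReal_nonneg
    simp only [hF]
    linarith
  have hfin : {t | t ∈ I ∧ s t = F t}.Finite := by
    refine Finite.of_finite_image (f := s) (hs.subset (image_mono fun t ht => hIsub ht.1)) ?_
    intro t ht t' ht' htt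
    exact hmono.injOn ht.1 ht'.1 (by rw [← ht.2, ← ht'.2, htt])
  have hnull : ∀ᵐ t ∂(volume.restrict I), t ∉ {t | t ∈ I ∧ s t = F t} :=
    ae_restrict_of_ae (measure_eq_zero_iff_ae_notMem.1 (hfin.measure_zero _))
  have hfalse : ∀ᵐ t ∂(volume.restrict I), False := by
    filter_upwards [hnull, ae_restrict_of_ae_restrict_of_subset hIsub hsF,
      ae_restrict_mem measurableSet_Ioo] with t h1 h2 h3
    exact h1 ⟨h3, h2⟩
  have : volume I = 0 := by simpa [ae_iff] using hfalse
  rw [hI, Real.volume_Ioo, ENNReal.ofReal_eq_zero] at this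
  linarith

theorem eq_zero_of_finite_image {a b c x : ℝ} {s : ℝ → ℝ} {W : ℝ → EReal} {μp μn : Measure ℝ}
    [IsFiniteMeasure μp] [IsFiniteMeasure μn] (hW : ContinuousOn W (Icc a b))
    (hWh : ∀ᵐ x ∂(volume.restrict (Ioo a b)), W x = (uaD μp μn x : EReal))
    (hs : (s '' Ioo a b).Finite)
    (hsF : ∀ᵐ x ∂(volume.restrict (Ioo a b)), s x = c + (μp.real (Iic x) - μn.real (Iic x)))
    (hp : (μp.singularPart volume) (ZPlus a b (uaD μp μn))ᶜ = 0)
    (hn : (μn.singularPart volume) (ZMinus a b (uaD μp μn))ᶜ = 0) (hx : x ∈ Ioo a b) :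
    W x = 0 := by
  refine le_antisymm (le_zero_of_finite_image hW hWh hs hsF hn hx) ?_
  have hneg : -W x ≤ 0 := by
    refine le_zero_of_finite_image (s := fun x => -s x) (c := -c) (μp := μn) (μn := μp)
      (W := fun x => -W x) (continuous_neg.comp_continuousOn hW) ?_ ?_ ?_ ?_ hx
    · simpa only [uaD_swap μp μn] using neg_ae_eq hWh
    · have := hs.image Neg.neg
      rwa [image_image] at this
    · exact hsF.mono fun x hx => by rw [hx]; ring
    · rw [ZMinus_eq_ZPlus_neg]
      simpa only [uaD_swap μp μn, neg_neg] using hp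
  rwa [EReal.neg_le, neg_zero] at hneg

/-- A positive atom of the derivative forces the density to be infinite there. -/
theorem mem_of_singularPart_compl_eq_zero {μ : Measure ℝ} [IsFiniteMeasure μ] {Z : Set ℝ} {x : ℝ}
    (hZ : (μ.singularPart volume) Zᶜ = 0) (hx : 0 < μ.real {x}) : x ∈ Z := by
  by_contra h
  have h1 : (μ.singularPart volume).real {x} = 0 := by
    rw [measureReal_eq_zero_iff]
    exact measure_mono_null (singleton_subset_iff.2 h) hZ
  rw [measureReal_eq_singularPart_add, h1] at hx
  simp at hx

end

noncomputable section
open MeasureTheory Filter Set Topology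
open scoped ENNReal NNReal

/-- for `u ∈ X^p_ψ(]a,b[)` (`p > 1`), the density `(u')ᵃ` has a continuous
extended-real-valued representative `W` on `[a,b]`;  `Z^±[(u')ᵃ] = {(u')ᵃ = ±∞}`;
`(u')ᵃ → ±∞` at jump points with positive/negative jump; and in particular no
nonconstant piecewise constant function belongs to `X^p_ψ(]a,b[)`. -/
theorem statement_5 (a b p : ℝ) (hab : a < b) (hp : 1 < p)
    (ψ : ℝ → ℝ) (hψ : PsiHypP ψ p)
    (u : ℝ → ℝ) (μp μn : Measure ℝ) (hX : MemXp ψ p a b u μp μn) :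
    (∃ W : ℝ → EReal,
      ContinuousOn W (Set.Icc a b) ∧
      (∀ᵐ x ∂(MeasureTheory.volume.restrict (Set.Ioo a b)),
        W x = ((uaD μp μn x : ℝ) : EReal)) ∧
      ZPlus a b (uaD μp μn) = {x | x ∈ Set.Ioo a b ∧ W x = ⊤} ∧
      ZMinus a b (uaD μp μn) = {x | x ∈ Set.Ioo a b ∧ W x = ⊥} ∧
      (∀ x₀ ∈ jumpSet a b u, 0 < rightApproxLim u x₀ - leftApproxLim u x₀ →
        Tendsto W (𝓝[Set.Ioo a b \ {x₀}] x₀) (𝓝 (⊤ : EReal))) ∧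
      (∀ x₀ ∈ jumpSet a b u, rightApproxLim u x₀ - leftApproxLim u x₀ < 0 →
        Tendsto W (𝓝[Set.Ioo a b \ {x₀}] x₀) (𝓝 (⊥ : EReal)))) ∧
    -- no nonconstant piecewise constant function belongs to `X^p_ψ`:
    (∀ s : ℝ → ℝ, (s '' Set.Ioo a b).Finite →
      (∀ᵐ x ∂(MeasureTheory.volume.restrict (Set.Ioo a b)), u x = s x) →
      ∃ cst : ℝ, ∀ᵐ x ∂(MeasureTheory.volume.restrict (Set.Ioo a b)), u x = cst) := by
  obtain ⟨hD, hv, hsp, hsn⟩ := hX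
  have hfp : IsFiniteMeasure μp := hD.2.1
  have hfn : IsFiniteMeasure μn := hD.2.2.1
  obtain ⟨G, hGc, hG⟩ := hv.exists_continuousOn hab
  obtain ⟨c, hc⟩ := hD.exists_ae_eq_const_add hab
  have hm := hψ.strictMono_Psip
  have hcont := hψ.continuous_Psip
  obtain ⟨W, hW, hWh⟩ : ∃ W : ℝ → EReal, ContinuousOn W (Icc a b) ∧
      ∀ᵐ x ∂(volume.restrict (Ioo a b)), W x = ((uaD μp μn x : ℝ) : EReal) :=
    ⟨fun x => invE (Psip ψ p) (G x), (continuous_invE hm hcont).comp_continuousOn hGc,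
      hG.mono fun x hx => by simp only [hx, invE_apply hm hcont]⟩
  have hi := integrable_uaD μp μn
  have hZp := ZPlus_eq hW hi hWh
  have hZn := ZMinus_eq hW hi hWh
  have hlim : ∀ x₀ ∈ Ioo a b, Tendsto W (𝓝[Ioo a b \ {x₀}] x₀) (𝓝 (W x₀)) := fun x₀ hx₀ =>
    (hW.continuousAt (Icc_mem_nhds hx₀.1 hx₀.2)).tendsto.mono_left nhdsWithin_le_nhds
  refine ⟨⟨W, hW, hWh, hZp, hZn, fun x₀ hx₀ hj => ?_, fun x₀ hx₀ hj => ?_⟩, fun s hs hus => ?_⟩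
  · rw [rightApproxLim_sub_leftApproxLim hx₀.1 hD.1 hc] at hj
    have hx : x₀ ∈ ZPlus a b (uaD μp μn) := mem_of_singularPart_compl_eq_zero hsp
      (by linarith [measureReal_nonneg (μ := μn) (s := {x₀})])
    rw [hZp] at hx
    simpa only [hx.2] using hlim x₀ hx₀.1
  · rw [rightApproxLim_sub_leftApproxLim hx₀.1 hD.1 hc] at hj
    have hx : x₀ ∈ ZMinus a b (uaD μp μn) := mem_of_singularPart_compl_eq_zero hsn
      (by linarith [measureReal_nonneg (μ := μp) (s := {x₀})])
    rw [hZn] at hx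
    simpa only [hx.2] using hlim x₀ hx₀.1
  · have hsF : ∀ᵐ x ∂(volume.restrict (Ioo a b)),
        s x = c + (μp.real (Iic x) - μn.real (Iic x)) := by
      filter_upwards [hc, hus] with x h1 h2
      rw [← h2, h1]
    have hW0 : ∀ x ∈ Ioo a b, W x = 0 := fun x hx =>
      eq_zero_of_finite_image hW hWh hs hsF hsp hsn hx
    have hua : ∀ᵐ x ∂(volume.restrict (Ioo a b)), uaD μp μn x = 0 := by
      filter_upwards [hWh, ae_restrict_mem measurableSet_Ioo] with x h1 h2
      rw [hW0 x h2] at h1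
      exact EReal.coe_eq_zero.1 h1.symm
    have hsing : ∀ S ⊆ Ioo a b, (μp.singularPart volume).real S = 0 ∧
        (μn.singularPart volume).real S = 0 := by
      intro S hS
      rw [measureReal_eq_zero_iff, measureReal_eq_zero_iff]
      refine ⟨measure_mono_null (fun t ht => ?_) hsp,
        measure_mono_null (fun t ht => ?_) hsn⟩
      · intro htZ
        rw [hZp] at htZ
        simp [hW0 t (hS ht)] at htZ
      · intro htZ
        rw [hZn] at htZ
        simp [hW0 t (hS ht)] at htZ
    have hconst : ∀ y ∈ Ioo a b, ∀ z ∈ Ioo a b, y ≤ z →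
        μp.real (Iic z) - μn.real (Iic z) = μp.real (Iic y) - μn.real (Iic y) := by
      intro y hy z hz hyz
      have hsub : Ioc y z ⊆ Ioo a b := fun t ht => ⟨hy.1.trans ht.1, ht.2.trans_lt hz.2⟩
      have hd := measureReal_Iic_sub_eq μp μn hyz
      rw [(hsing _ hsub).1, (hsing _ hsub).2,
        integral_eq_zero_of_ae (ae_restrict_of_ae_restrict_of_subset hsub hua)] at hd
      linarith
    obtain ⟨m, hm⟩ := nonempty_Ioo.2 hab
    refine ⟨c + (μp.real (Iic m) - μn.real (Iic m)), ?_⟩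
    filter_upwards [hc, ae_restrict_mem measurableSet_Ioo] with x h1 h2
    rw [h1]
    rcases le_total m x with h | h
    · rw [hconst m hm x h2 h]
    · rw [hconst x h2 m hm h]
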